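/- For every ε with 0 < ε ≤ 1 and every real v with v² > 1/2, one has det(B^#(v, ε)⁻¹·A(v)) < 0; consequently the matrix B^#(v, ε)⁻¹·A(v) has two real eigenvalues of opposite sign. In particular this holds for v = √(v₋²(q̃)) for every q̃ ∈ (3/4, 1) (i.e., the rest point ψ₋(q̃) of the profile equations is a hyperbolic saddle). -/

import Mathlib

/-- `v₊²(q̃) = ((2q̃ − 1) − √(q̃(4q̃ − 3)))/(4(1 − q̃))`. -/
noncomputable def vplusSq (q : ℝ) : ℝ :=
  ((2 * q - 1) - Real.sqrt (q * (4 * q - 3))) / (4 * (1 - q))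

/-- `v₋²(q̃) = ((2q̃ − 1) + √(q̃(4q̃ − 3)))/(4(1 − q̃))`. -/
noncomputable def vminusSq (q : ℝ) : ℝ :=
  ((2 * q - 1) + Real.sqrt (q * (4 * q - 3))) / (4 * (1 - q))

/-- `u = √(1 + v²)`. -/
noncomputable def uu (v : ℝ) : ℝ := Real.sqrt (1 + v ^ 2)

/-- The dissipation matrix `B^#(v, ε) = ε·B_visc − B₁ − (9ε/(4 − ε))·B₂`. -/
noncomputable def Bsharp (v ε : ℝ) : Matrix (Fin 2) (Fin 2) ℝ :=
  ε • !![(uu v) ^ 2 * v ^ 2, -(uu v) ^ 3 * v; -(uu v) ^ 3 * v, (uu v) ^ 4]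
    - !![16 * (uu v) ^ 2 * v ^ 2, -4 * (uu v) * v * (4 * v ^ 2 + 1);
         -4 * (uu v) * v * (4 * v ^ 2 + 1), (4 * v ^ 2 + 1) ^ 2]
    - (9 * ε / (4 - ε)) • !![((uu v) ^ 2 + v ^ 2) ^ 2, -2 * ((uu v) ^ 2 + v ^ 2) * (uu v) * v;
         -2 * ((uu v) ^ 2 + v ^ 2) * (uu v) * v, 4 * (uu v) ^ 2 * v ^ 2]

/-- The matrix `A(v)` of the scaled linearization. -/
noncomputable def Amat (v : ℝ) : Matrix (Fin 2) (Fin 2) ℝ :=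
  !![v * (6 * v ^ 2 + 5), -(uu v) * (6 * v ^ 2 + 1);
     -(uu v) * (6 * v ^ 2 + 1), 3 * v * (2 * v ^ 2 + 1)]

open Polynomial in
/-- A real `2 × 2` matrix with negative determinant has two real eigenvalues of opposite sign. -/
theorem Matrix.exists_charpoly_eq_of_det_neg {M : Matrix (Fin 2) (Fin 2) ℝ} (h : M.det < 0) :
    ∃ a b : ℝ, a < 0 ∧ 0 < b ∧ M.charpoly = (X - C a) * (X - C b) := by
  have hdisc : 0 ≤ M.trace ^ 2 - 4 * M.det := by nlinarith [sq_nonneg M.trace]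
  have hsq := Real.sq_sqrt hdisc
  set s := Real.sqrt (M.trace ^ 2 - 4 * M.det)
  have hs : |M.trace| < s := Real.lt_sqrt_of_sq_lt (by rw [sq_abs]; linarith)
  obtain ⟨hs₁, hs₂⟩ := abs_lt.mp hs
  refine ⟨(M.trace - s) / 2, (M.trace + s) / 2, by linarith, by linarith, ?_⟩
  have htr : M.trace = (M.trace - s) / 2 + (M.trace + s) / 2 := by ring
  have hdet : M.det = (M.trace - s) / 2 * ((M.trace + s) / 2) := by linarith
  rw [Matrix.charpoly_fin_two]
  generalize (M.trace - s) / 2 = a at *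
  generalize (M.trace + s) / 2 = b at *
  rw [htr, hdet, C_add, C_mul]
  ring

theorem uu_sq (v : ℝ) : uu v ^ 2 = 1 + v ^ 2 := Real.sq_sqrt (by positivity)

theorem det_Amat (v : ℝ) : (Amat v).det = 2 * v ^ 2 - 1 := by
  rw [Amat, Matrix.det_fin_two_of]
  linear_combination (-(6 * v ^ 2 + 1) ^ 2) * uu_sq v

theorem det_Bsharp {ε : ℝ} (v : ℝ) (hε : ε ≠ 4) :
    (Bsharp v ε).det = 9 * ε / (4 - ε) * (1 - 8 * v ^ 2 - ε * (1 + v ^ 2)) := by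
  have h4 : 4 - ε ≠ 0 := sub_ne_zero.mpr hε.symm
  have hκ : 9 * ε / (4 - ε) * (4 - ε) = 9 * ε := div_mul_cancel₀ _ h4
  have key : (Bsharp v ε).det =
      -(9 * ε) * v ^ 2 * uu v ^ 2 * (4 * uu v ^ 2 - 4 * v ^ 2 - 1) ^ 2 / 9
        - ε * (9 * ε / (4 - ε)) * (uu v ^ 2) ^ 2 * (uu v ^ 2 - v ^ 2) ^ 2
        + 9 * ε / (4 - ε) * ((4 * v ^ 2 + 1) * (uu v ^ 2 + v ^ 2) - 8 * uu v ^ 2 * v ^ 2) ^ 2 := by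
    simp only [Bsharp, Matrix.det_fin_two, Matrix.sub_apply, Matrix.smul_apply, smul_eq_mul,
      Matrix.of_apply, Matrix.cons_val', Matrix.cons_val_zero, Matrix.cons_val_one,
      Matrix.cons_val_fin_one]
    ring
  rw [key, uu_sq]
  linear_combination (v ^ 2 * (1 + v ^ 2)) * hκ

theorem det_Bsharp_neg {ε v : ℝ} (hε : 0 < ε) (hε' : ε < 4) (hv : 1 / 8 ≤ v ^ 2) :
    (Bsharp v ε).det < 0 := by
  rw [det_Bsharp v hε'.ne]
  have hpos : 0 < ε * (1 + v ^ 2) := by positivity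
  exact mul_neg_of_pos_of_neg (div_pos (by linarith) (by linarith)) (by linarith)

theorem det_inv_Bsharp_mul_Amat_neg {ε v : ℝ} (hε : 0 < ε) (hε' : ε < 4) (hv : 1 / 2 < v ^ 2) :
    ((Bsharp v ε)⁻¹ * Amat v).det < 0 := by
  rw [Matrix.det_mul, Matrix.det_nonsing_inv, Ring.inverse_eq_inv', det_Amat]
  exact mul_neg_of_neg_of_pos (inv_lt_zero.mpr (det_Bsharp_neg hε hε' (by linarith)))
    (by linarith)

theorem half_lt_vminusSq {q : ℝ} (hq : 3 / 4 < q) (hq' : q < 1) : 1 / 2 < vminusSq q := by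
  rw [vminusSq, lt_div_iff₀ (by linarith)]
  linarith [Real.sqrt_nonneg (q * (4 * q - 3))]

open Polynomial in
/-- For `0 < ε ≤ 1` and `v² > 1/2` one has `det(B^#(v, ε)⁻¹·A(v)) < 0`, so the matrix
has two real eigenvalues of opposite sign; in particular this holds for
`v = √(v₋²(q̃))`, `q̃ ∈ (3/4, 1)`: `ψ₋(q̃)` is a hyperbolic saddle. -/
theorem psi_minus_saddle :
    (∀ ε v : ℝ, 0 < ε → ε ≤ 1 → 1 / 2 < v ^ 2 →
      ((Bsharp v ε)⁻¹ * Amat v).det < 0 ∧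
      ∃ a b : ℝ, a < 0 ∧ 0 < b ∧
        Matrix.charpoly ((Bsharp v ε)⁻¹ * Amat v) = (X - C a) * (X - C b)) ∧
    (∀ ε q : ℝ, 0 < ε → ε ≤ 1 → 3 / 4 < q → q < 1 →
      ((Bsharp (Real.sqrt (vminusSq q)) ε)⁻¹ * Amat (Real.sqrt (vminusSq q))).det < 0 ∧
      ∃ a b : ℝ, a < 0 ∧ 0 < b ∧
        Matrix.charpoly ((Bsharp (Real.sqrt (vminusSq q)) ε)⁻¹ * Amat (Real.sqrt (vminusSq q)))
          = (X - C a) * (X - C b)) := by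
  refine ⟨fun ε v hε hε' hv => ?_, fun ε q hε hε' hq hq' => ?_⟩
  · have hdet := det_inv_Bsharp_mul_Amat_neg hε (by linarith) hv
    exact ⟨hdet, Matrix.exists_charpoly_eq_of_det_neg hdet⟩
  · have hv := half_lt_vminusSq hq hq'
    have hdet := det_inv_Bsharp_mul_Amat_neg (v := Real.sqrt (vminusSq q)) hε (by linarith)
      (by rwa [Real.sq_sqrt (by linarith)])
    exact ⟨hdet, Matrix.exists_charpoly_eq_of_det_neg hdet⟩
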